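/- Let A = ⟨α, β, {A_a}⟩ be a WFA of dimension n over a finite alphabet Σ such that the spectral radius of M = Σ_{a∈Σ} A_a ⊗ A_a is strictly less than 1. Then the Gramians G_p and G_s are well-defined and: (1) x = vec(G_p) is the unique solution of the linear system (α⊗α)ᵀ = xᵀ(I − M); (2) y = vec(G_s) is the unique solution of the linear system (β⊗β) = (I − M) y. -/

import Mathlib

open scoped ENNReal
open scoped Kronecker
open Matrix

noncomputable section

/-- A weighted finite automaton of dimension `n` over alphabet `S`,
with initial weights, final weights and transition matrices. -/
structure WFA (S : Type*) (n : ℕ) where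
  init : Fin n → ℝ
  final : Fin n → ℝ
  trans : S → Matrix (Fin n) (Fin n) ℝ

namespace WFA

variable {S : Type*} {n : ℕ}

/-- `A_x = A_{x₁} ⋯ A_{x_t}` (identity for the empty string). -/
def matOf (M : WFA S n) (x : List S) : Matrix (Fin n) (Fin n) ℝ :=
  (x.map M.trans).prod

/-- The function computed by the WFA: `f_A(x) = αᵀ A_x β`. -/
def f (M : WFA S n) (x : List S) : ℝ :=
  M.init ⬝ᵥ (M.matOf x).mulVec M.final

/-- Row `p` of the forward matrix: `αᵀ A_p`. -/
def fwd (M : WFA S n) (x : List S) : Fin n → ℝ :=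
  Matrix.vecMul M.init (M.matOf x)

/-- Row `s` of the backward matrix: `(A_s β)ᵀ`. -/
def bwd (M : WFA S n) (x : List S) : Fin n → ℝ :=
  (M.matOf x).mulVec M.final

/-- `M` is a minimal WFA: no WFA of strictly smaller dimension computes the same function. -/
def Min (M : WFA S n) : Prop :=
  ∀ m : ℕ, (∃ B : WFA S m, B.f = M.f) → n ≤ m

/-- The reachability Gramian `G_p = Pᵀ P` is well-defined: all its defining sums converge. -/
def GpDefined (M : WFA S n) : Prop :=
  ∀ i j, Summable fun x : List S => M.fwd x i * M.fwd x j

/-- The observability Gramian `G_s = Sᵀ S` is well-defined: all its defining sums converge. -/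
def GsDefined (M : WFA S n) : Prop :=
  ∀ i j, Summable fun x : List S => M.bwd x i * M.bwd x j

/-- The reachability Gramian `G_p = Pᵀ P`. -/
def Gp (M : WFA S n) : Matrix (Fin n) (Fin n) ℝ :=
  Matrix.of fun i j => ∑' x : List S, M.fwd x i * M.fwd x j

/-- The observability Gramian `G_s = Sᵀ S`. -/
def Gs (M : WFA S n) : Matrix (Fin n) (Fin n) ℝ :=
  Matrix.of fun i j => ∑' x : List S, M.bwd x i * M.bwd x j

/-- Truncation of a WFA to its first `m` states. -/
def trunc (M : WFA S n) (m : ℕ) (h : m ≤ n) : WFA S m where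
  init := fun i => M.init (Fin.castLE h i)
  final := fun i => M.final (Fin.castLE h i)
  trans := fun a => Matrix.of fun i j => M.trans a (Fin.castLE h i) (Fin.castLE h j)

end WFA

/-- A function `f : Σ* → ℝ` is rational if it is computed by some WFA. -/
def IsRational {S : Type*} (f : List S → ℝ) : Prop :=
  ∃ (n : ℕ) (M : WFA S n), M.f = f

/-- Spectral radius of a real square matrix: the largest modulus of its complex eigenvalues. -/
def specRad {d : Type*} [Fintype d] [DecidableEq d] (M : Matrix d d ℝ) : ℝ≥0∞ :=
  spectralRadius ℂ (M.map (algebraMap ℝ ℂ))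

/-- Induced ∞-norm of a matrix: maximum absolute row sum. -/
def normInfM {d e : Type*} [Fintype d] [Fintype e] (M : Matrix d e ℝ) : ℝ :=
  ⨆ i, ∑ j, |M i j|

/-- Induced 1-norm of a matrix: maximum absolute column sum. -/
def normOneM {d e : Type*} [Fintype d] [Fintype e] (M : Matrix d e ℝ) : ℝ :=
  ⨆ j, ∑ i, |M i j|

/-- The `p`-norm of a finite-dimensional real vector, `1 ≤ p ≤ ∞`. -/
def vecPNorm {d : Type*} [Fintype d] (p : ℝ≥0∞) (v : d → ℝ) : ℝ :=
  if p = ⊤ then ⨆ i, |v i| else (∑ i, |v i| ^ p.toReal) ^ (1 / p.toReal)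

/-- The induced matrix `p`-norm `‖M‖_p = sup_{‖v‖_p = 1} ‖Mv‖_p`. -/
def inducedPNorm {d : Type*} [Fintype d] (p : ℝ≥0∞) (M : Matrix d d ℝ) : ℝ :=
  sSup {r | ∃ v : d → ℝ, vecPNorm p v = 1 ∧ r = vecPNorm p (M.mulVec v)}

/-- The operator norm of the Hankel operator of `f` on `ℓ²`. -/
def hankelOpNorm {S : Type*} (f : List S → ℝ) : ℝ :=
  sSup {r | ∃ g : List S → ℝ, (Summable fun y => g y ^ 2) ∧ (∑' y, g y ^ 2) ≤ 1 ∧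
    (Summable fun x : List S => (∑' y : List S, f (x ++ y) * g y) ^ 2) ∧
    r = Real.sqrt (∑' x : List S, (∑' y : List S, f (x ++ y) * g y) ^ 2)}

end

section Helpers

attribute [local instance] Matrix.linftyOpNormedRing Matrix.linftyOpNormedAlgebra

/-- In a complex Banach algebra, the geometric series of an element of spectral radius less
than one converges. -/
theorem summable_pow_of_spectralRadius_lt_one {A : Type*} [NormedRing A] [NormedAlgebra ℂ A]
    [CompleteSpace A] {a : A} (ha : spectralRadius ℂ a < 1) : Summable fun t : ℕ => a ^ t := by
  obtain ⟨r, har, hr⟩ := ENNReal.lt_iff_exists_nnreal_btwn.mp ha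
  have hr1 : r < 1 := by exact_mod_cast hr
  have hev : ∀ᶠ t : ℕ in Filter.atTop, ‖a ^ t‖ ≤ (r : ℝ) ^ t := by
    filter_upwards [(spectrum.pow_nnnorm_pow_one_div_tendsto_nhds_spectralRadius a).eventually
      (gt_mem_nhds har), Filter.eventually_gt_atTop 0] with t ht ht0
    rw [one_div, ENNReal.rpow_inv_lt_iff (by exact_mod_cast ht0), ENNReal.rpow_natCast] at ht
    exact_mod_cast ht.le
  exact Summable.of_norm_bounded_eventually_nat
    (summable_geometric_of_lt_one r.coe_nonneg (by exact_mod_cast hr1)) hev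

theorem summable_pow_of_specRad_lt_one {d : Type*} [Fintype d] [DecidableEq d]
    {K : Matrix d d ℝ} (hK : specRad K < 1) : Summable fun t : ℕ => K ^ t := by
  have h := summable_pow_of_spectralRadius_lt_one hK
  refine Pi.summable.mpr fun i => Pi.summable.mpr fun j => ?_
  have hij := Pi.summable.mp (Pi.summable.mp h i) j
  rw [← Complex.summable_ofReal]
  refine hij.congr fun t => ?_
  rw [← Matrix.map_pow]
  rfl

end Helpers

/-- If the sums of `u x i * u x j` over the words `x` of each given length form a summable
sequence, then the sum over all words converges to the total. -/
theorem hasSum_list_mul {S : Type*} [Fintype S] {d : Type*} {u : List S → d → ℝ}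
    {w : ℕ → d × d → ℝ}
    (hw : ∀ t i j, ∑ x : Fin t → S, u (List.ofFn x) i * u (List.ofFn x) j = w t (i, j))
    (hs : ∀ p, Summable fun t => w t p) (i j : d) :
    HasSum (fun x => u x i * u x j) (∑' t, w t (i, j)) := by
  have hsq (i : d) : Summable fun x => u x i * u x i := by
    rw [← List.equivSigmaTuple.symm.summable_iff]
    refine (summable_sigma_of_nonneg fun _ => mul_self_nonneg _).mpr ⟨fun t => Summable.of_finite, (hs (i, i)).congr fun t => ?_⟩
    rw [← hw, tsum_fintype]
    rfl
  have hij : Summable fun x => u x i * u x j :=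
    Summable.of_norm_bounded ((hsq i).add (hsq j)) fun x => by
      rw [Real.norm_eq_abs, abs_le]
      constructor <;> nlinarith [sq_nonneg (u x i + u x j), sq_nonneg (u x i - u x j),
        sq_nonneg (u x i), sq_nonneg (u x j)]
  convert hij.hasSum using 1
  have h2 := List.equivSigmaTuple.symm.summable_iff.mpr hij
  rw [← List.equivSigmaTuple.symm.tsum_eq]
  refine (tsum_congr fun t => ?_).trans (h2.tsum_sigma' fun _ => Summable.of_finite).symm
  rw [← hw, tsum_fintype]
  rfl

namespace WFA

variable {S : Type*} [Fintype S] {n : ℕ} (M : WFA S n)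

theorem sum_matOf_kronecker_matOf (t : ℕ) :
    ∑ x : Fin t → S, M.matOf (List.ofFn x) ⊗ₖ M.matOf (List.ofFn x) =
      (∑ a : S, M.trans a ⊗ₖ M.trans a) ^ t := by
  induction t with
  | zero => simp [matOf]
  | succ t ih =>
    rw [pow_succ', ← ih, Finset.sum_mul_sum, ← Fintype.sum_prod_type',
      ← (Fin.consEquiv fun _ : Fin (t + 1) => S).sum_comp]
    simp [matOf, Fin.consEquiv, List.ofFn_succ, Matrix.mul_kronecker_mul]

theorem sum_fwd_mul_fwd (t : ℕ) (i j : Fin n) :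
    ∑ x : Fin t → S, M.fwd (List.ofFn x) i * M.fwd (List.ofFn x) j =
      ((fun p : Fin n × Fin n => M.init p.1 * M.init p.2) ᵥ*
        (∑ a : S, M.trans a ⊗ₖ M.trans a) ^ t) (i, j) := by
  rw [← sum_matOf_kronecker_matOf, Matrix.vecMul_sum, Finset.sum_apply]
  refine Finset.sum_congr rfl fun x _ => ?_
  simp only [fwd, Matrix.vecMul, dotProduct, Matrix.kroneckerMap_apply, Fintype.sum_prod_type,
    Finset.sum_mul_sum]
  exact Finset.sum_congr rfl fun _ _ => Finset.sum_congr rfl fun _ _ => by ring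

theorem sum_bwd_mul_bwd (t : ℕ) (i j : Fin n) :
    ∑ x : Fin t → S, M.bwd (List.ofFn x) i * M.bwd (List.ofFn x) j =
      ((∑ a : S, M.trans a ⊗ₖ M.trans a) ^ t *ᵥ
        fun p : Fin n × Fin n => M.final p.1 * M.final p.2) (i, j) := by
  rw [← sum_matOf_kronecker_matOf, Matrix.sum_mulVec, Finset.sum_apply]
  refine Finset.sum_congr rfl fun x _ => ?_
  simp only [bwd, Matrix.mulVec, dotProduct, Matrix.kroneckerMap_apply, Fintype.sum_prod_type,
    Finset.sum_mul_sum]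
  exact Finset.sum_congr rfl fun _ _ => Finset.sum_congr rfl fun _ _ => by ring

end WFA

/-- if `ρ(∑_a A_a ⊗ A_a) < 1` then the Gramians are well-defined, and
`vec(G_p)` (resp. `vec(G_s)`) is the unique solution of `(α⊗α)ᵀ = xᵀ(I − M)`
(resp. `(β⊗β) = (I − M) y`), where `M = ∑_a A_a ⊗ A_a`. -/
theorem gramians_unique_linear_solution {S : Type*} [Fintype S] {n : ℕ} (M : WFA S n)
    (hρ : specRad (∑ a : S, M.trans a ⊗ₖ M.trans a) < 1) :
    M.GpDefined ∧ M.GsDefined ∧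
    (Matrix.vecMul (fun ij : Fin n × Fin n => M.Gp ij.1 ij.2)
        (1 - ∑ a : S, M.trans a ⊗ₖ M.trans a) =
      fun ij : Fin n × Fin n => M.init ij.1 * M.init ij.2) ∧
    (∀ x : Fin n × Fin n → ℝ,
      Matrix.vecMul x (1 - ∑ a : S, M.trans a ⊗ₖ M.trans a) =
          (fun ij : Fin n × Fin n => M.init ij.1 * M.init ij.2) →
        x = fun ij : Fin n × Fin n => M.Gp ij.1 ij.2) ∧
    (Matrix.mulVec (1 - ∑ a : S, M.trans a ⊗ₖ M.trans a)
        (fun ij : Fin n × Fin n => M.Gs ij.1 ij.2) =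
      fun ij : Fin n × Fin n => M.final ij.1 * M.final ij.2) ∧
    (∀ y : Fin n × Fin n → ℝ,
      Matrix.mulVec (1 - ∑ a : S, M.trans a ⊗ₖ M.trans a) y =
          (fun ij : Fin n × Fin n => M.final ij.1 * M.final ij.2) →
        y = fun ij : Fin n × Fin n => M.Gs ij.1 ij.2) := by
  set K := ∑ a : S, M.trans a ⊗ₖ M.trans a with hK
  have hs : Summable fun t : ℕ => K ^ t := summable_pow_of_specRad_lt_one hρ
  have hl : (∑' t : ℕ, K ^ t) * (1 - K) = 1 := hs.tsum_pow_mul_one_sub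
  have hr : (1 - K) * ∑' t : ℕ, K ^ t = 1 := hs.one_sub_mul_tsum_pow
  have hvecMul (v : Fin n × Fin n → ℝ) : HasSum (fun t => v ᵥ* K ^ t) (v ᵥ* ∑' t, K ^ t) :=
    hs.hasSum.map (Matrix.vecMulBilin ℝ ℝ v).toAddMonoidHom (by
      exact continuous_const.matrix_vecMul continuous_id)
  have hmulVec (v : Fin n × Fin n → ℝ) : HasSum (fun t => K ^ t *ᵥ v) ((∑' t, K ^ t) *ᵥ v) :=
    hs.hasSum.map ((Matrix.mulVecBilin ℝ ℝ).flip v).toAddMonoidHom (by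
      exact continuous_id.matrix_mulVec continuous_const)
  have hp := hasSum_list_mul M.sum_fwd_mul_fwd
    fun p => (Pi.hasSum.mp (hvecMul fun p => M.init p.1 * M.init p.2) p).summable
  have hq := hasSum_list_mul M.sum_bwd_mul_bwd
    fun p => (Pi.hasSum.mp (hmulVec fun p => M.final p.1 * M.final p.2) p).summable
  have hGp : (fun p : Fin n × Fin n => M.Gp p.1 p.2) =
      (fun p => M.init p.1 * M.init p.2) ᵥ* ∑' t, K ^ t := by
    ext p
    exact (hp p.1 p.2).tsum_eq.trans (Pi.hasSum.mp (hvecMul _) p).tsum_eq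
  have hGs : (fun p : Fin n × Fin n => M.Gs p.1 p.2) =
      (∑' t, K ^ t) *ᵥ fun p => M.final p.1 * M.final p.2 := by
    ext p
    exact (hq p.1 p.2).tsum_eq.trans (Pi.hasSum.mp (hmulVec _) p).tsum_eq
  refine ⟨fun i j => (hp i j).summable, fun i j => (hq i j).summable, ?_, fun x hx => ?_, ?_,
    fun y hy => ?_⟩
  · rw [hGp, Matrix.vecMul_vecMul, hl, Matrix.vecMul_one]
  · rw [hGp, ← hx, Matrix.vecMul_vecMul, hr, Matrix.vecMul_one]
  · rw [hGs, Matrix.mulVec_mulVec, hr, Matrix.one_mulVec]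
  · rw [hGs, ← hy, Matrix.mulVec_mulVec, hl, Matrix.one_mulVec]
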